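/- Let V be a finite-dimensional complex vector space with dim V = n ≥ 1, and let W = V ⊕ V* carry the hyperbolic symmetric bilinear form Q((v,f),(v′,f′)) = f(v′) + f′(v). Let φ : W → ℂ be an isotropic linear functional (i.e. φ(w_φ) = 0, where w_φ ∈ W is the unique vector with Q(w_φ, −) = φ) whose restriction to the subspace V ⊕ 0 is nonzero. Then: (i) the line ℂ·w_φ intersects V ⊕ 0 trivially; (ii) w_φ ∈ ker φ, the quotient ker φ / ℂ·w_φ has dimension 2n − 2, and the image of ker(φ|_{V ⊕ 0}) under the quotient map ker φ → ker φ / ℂ·w_φ is a subspace of dimension n − 1 on which the bilinear form induced by Q vanishes identically; hence this image is a maximal isotropic subspace of ker φ / ℂ·w_φ. -/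

import Mathlib

open Module Submodule LinearMap

/-- Let `V` be a finite-dimensional complex vector space of dimension `n ≥ 1`, and let
`W = V ⊕ V*` carry the hyperbolic symmetric bilinear form
`Q((v,f),(v',f')) = f(v') + f'(v)`.  Let `φ : W → ℂ` be an isotropic linear functional
(i.e. `φ(w_φ) = 0`, where `w_φ` is the unique vector with `Q(w_φ, -) = φ`) whose
restriction to `V ⊕ 0` is nonzero.  Then:
(i) the line `ℂ·w_φ` intersects `V ⊕ 0` trivially;
(ii) `w_φ ∈ ker φ`, the quotient `ker φ / ℂ·w_φ` has dimension `2n - 2`, and the image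
of `ker (φ|_{V ⊕ 0})` under the quotient map `ker φ → ker φ / ℂ·w_φ` is a subspace of
dimension `n - 1` on which the bilinear form induced by `Q` vanishes identically
(equivalently, `Q` vanishes on all lifts); hence this image is a maximal isotropic
subspace of `ker φ / ℂ·w_φ`. -/
theorem maximal_isotropic_reduction
    (V : Type*) [AddCommGroup V] [Module ℂ V] [FiniteDimensional ℂ V]
    (n : ℕ) (hn : 1 ≤ n) (hdim : Module.finrank ℂ V = n)
    (Q : (V × Module.Dual ℂ V) →ₗ[ℂ] (V × Module.Dual ℂ V) →ₗ[ℂ] ℂ)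
    (hQ : ∀ (v v' : V) (f f' : Module.Dual ℂ V), Q (v, f) (v', f') = f v' + f' v)
    (φ : (V × Module.Dual ℂ V) →ₗ[ℂ] ℂ)
    (wφ : V × Module.Dual ℂ V)
    (hwφ : ∀ w, Q wφ w = φ w)
    (hwφ_unique : ∀ w' : V × Module.Dual ℂ V, (∀ w, Q w' w = φ w) → w' = wφ)
    (hiso : φ wφ = 0)
    (hres : ∃ v : V, φ (v, 0) ≠ 0) :
    -- (i) the line `ℂ·w_φ` meets `V ⊕ 0` trivially
    Submodule.span ℂ {wφ} ⊓
      Submodule.prod (⊤ : Submodule ℂ V) (⊥ : Submodule ℂ (Module.Dual ℂ V)) = ⊥ ∧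
    -- (ii) `w_φ ∈ ker φ`, ...
    wφ ∈ LinearMap.ker φ ∧
    -- ... the quotient `ker φ / ℂ·w_φ` has dimension `2n - 2`, ...
    Module.finrank ℂ
      ((LinearMap.ker φ) ⧸
        (Submodule.span ℂ {(⟨wφ, LinearMap.mem_ker.mpr hiso⟩ : LinearMap.ker φ)})) =
      2 * n - 2 ∧
    -- ... the image of `ker (φ|_{V ⊕ 0})` in the quotient has dimension `n - 1`, ...
    Module.finrank ℂ
      (Submodule.map
        (Submodule.span ℂ {(⟨wφ, LinearMap.mem_ker.mpr hiso⟩ : LinearMap.ker φ)}).mkQ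
        ((Submodule.prod (⊤ : Submodule ℂ V) (⊥ : Submodule ℂ (Module.Dual ℂ V)) ⊓
            LinearMap.ker φ).comap (LinearMap.ker φ).subtype)) = n - 1 ∧
    -- ... and the form induced by `Q` vanishes identically on this image
    ∀ x ∈ Submodule.prod (⊤ : Submodule ℂ V) (⊥ : Submodule ℂ (Module.Dual ℂ V)) ⊓
        LinearMap.ker φ,
      ∀ y ∈ Submodule.prod (⊤ : Submodule ℂ V) (⊥ : Submodule ℂ (Module.Dual ℂ V)) ⊓
        LinearMap.ker φ,
      Q x y = 0 := by
  obtain ⟨v0, hv0⟩ := hres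
  have hw2 : wφ.2 ≠ 0 := by
    intro h
    apply hv0
    rw [← hwφ]
    refine (hQ wφ.1 v0 wφ.2 0).trans ?_
    simp [h]
  have hw : wφ ≠ 0 := fun h => hw2 (by rw [h]; rfl)
  have key : ∀ c : ℂ, (c • wφ).2 = 0 → c = 0 := by
    intro c hc
    have h1 : c • wφ.2 = 0 := hc
    exact (smul_eq_zero.mp h1).resolve_right hw2
  have hφ : φ ≠ 0 := fun h => hv0 (by rw [h]; rfl)
  have hk : Module.finrank ℂ (LinearMap.ker φ) + 1 = 2 * n := by
    have h1 := Module.Dual.finrank_ker_add_one_of_ne_zero (f := φ) hφ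
    rw [Module.finrank_prod, Subspace.dual_finrank_eq, hdim] at h1
    omega
  refine ⟨?_, hiso, ?_, ?_, ?_⟩
  · rw [eq_bot_iff]
    rintro x ⟨hx1, hx2⟩
    obtain ⟨c, rfl⟩ := Submodule.mem_span_singleton.mp hx1
    have h2 : (c • wφ).2 = 0 := hx2.2
    simp [key c h2]
  · have h1 := Submodule.finrank_quotient_add_finrank
      (Submodule.span ℂ {(⟨wφ, LinearMap.mem_ker.mpr hiso⟩ : LinearMap.ker φ)})
    rw [finrank_span_singleton (by simpa [Subtype.ext_iff] using hw)] at h1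
    omega
  · let ψ : V →ₗ[ℂ] ℂ := φ ∘ₗ LinearMap.inl ℂ V (Module.Dual ℂ V)
    have hψ : ψ ≠ 0 := fun h => hv0 (by
      have := LinearMap.congr_fun h v0
      simpa [ψ] using this)
    have hd := Module.Dual.finrank_ker_add_one_of_ne_zero (f := ψ) hψ
    let g : LinearMap.ker ψ →ₗ[ℂ] LinearMap.ker φ :=
      (LinearMap.inl ℂ V (Module.Dual ℂ V) ∘ₗ (LinearMap.ker ψ).subtype).codRestrict _
        (fun x => x.2)
    let S := Submodule.span ℂ {(⟨wφ, LinearMap.mem_ker.mpr hiso⟩ : LinearMap.ker φ)}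
    have hinj : Function.Injective (S.mkQ ∘ₗ g) := by
      rw [← LinearMap.ker_eq_bot, eq_bot_iff]
      intro x hx
      have h1 : g x ∈ S := by simpa using hx
      obtain ⟨c, hc⟩ := Submodule.mem_span_singleton.mp h1
      have h2 : c • wφ = ((x : V), (0 : Module.Dual ℂ V)) := congrArg Subtype.val hc
      have h3 := key c (by rw [h2])
      rw [h3, zero_smul] at h2
      have h4 : (0 : V) = x := congrArg Prod.fst h2
      exact Subtype.ext h4.symm
    have hr := LinearMap.finrank_range_of_inj hinj
    have he : (Submodule.prod (⊤ : Submodule ℂ V) (⊥ : Submodule ℂ (Module.Dual ℂ V)) ⊓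
            LinearMap.ker φ).comap (LinearMap.ker φ).subtype = LinearMap.range g := by
      ext x
      constructor
      · rintro ⟨⟨-, h2⟩, h3⟩
        have h2' : x.1.2 = 0 := h2
        have hx : ((x.1.1, 0) : V × Module.Dual ℂ V) = x.1 := Prod.ext rfl h2'.symm
        refine ⟨⟨x.1.1, ?_⟩, Subtype.ext hx⟩
        change φ (x.1.1, 0) = 0
        rw [hx]
        exact x.2
      · rintro ⟨y, rfl⟩
        exact ⟨⟨trivial, rfl⟩, (g y).2⟩
    rw [he, ← LinearMap.range_comp]
    change Module.finrank ℂ (LinearMap.range (S.mkQ ∘ₗ g)) = n - 1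
    omega
  · rintro ⟨x, f⟩ ⟨⟨-, hx⟩, -⟩ ⟨y, f'⟩ ⟨⟨-, hy⟩, -⟩
    have hx' : f = 0 := hx
    have hy' : f' = 0 := hy
    rw [hQ, hx', hy']
    simp
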